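/- The function κ(ω₁,ω₂) = conj(∇₂)G^m(ω₁,ω₂) − conj(α)(ω₂)·G^m(ω₁,ω₂) satisfies ∂̄₂κ(ω₁,ω₂) = (1/2)δ_{ω₁} − (conj(α)(ω₂)/2)·conj(κ)(ω₁,ω₂) in the sense of distributions; in particular κ(ω₁,·) is (−conj(α))-massive holomorphic away from ω₁. -/

import Mathlib

open Complex ComplexConjugate MeasureTheory

noncomputable def dX (f : ℂ → ℂ) (z : ℂ) : ℂ := fderiv ℝ f z 1
noncomputable def dY (f : ℂ → ℂ) (z : ℂ) : ℂ := fderiv ℝ f z Complex.I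
noncomputable def dbar (f : ℂ → ℂ) (z : ℂ) : ℂ := (dX f z + Complex.I * dY f z) / 2
noncomputable def dd (f : ℂ → ℂ) (z : ℂ) : ℂ := (dX f z - Complex.I * dY f z) / 2
noncomputable def lapC (f : ℂ → ℂ) (z : ℂ) : ℂ := dX (dX f) z + dY (dY f) z
noncomputable def dXr (u : ℂ → ℝ) (z : ℂ) : ℝ := fderiv ℝ u z 1
noncomputable def dYr (u : ℂ → ℝ) (z : ℂ) : ℝ := fderiv ℝ u z Complex.I
noncomputable def lapr (u : ℂ → ℝ) (z : ℂ) : ℝ := dXr (dXr u) z + dYr (dYr u) z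

namespace Aux4

open Set Filter Topology

lemma fderiv_apply_complex (ψ : ℂ → ℂ) (z v : ℂ) :
    fderiv ℝ ψ z v = v.re * dX ψ z + v.im * dY ψ z := by
  have : v = v.re • (1 : ℂ) + v.im • Complex.I := by
    apply Complex.ext <;> simp
  conv_lhs => rw [this]
  rw [map_add, map_smul, map_smul]
  simp [dX, dY]

noncomputable def ee (θ : ℝ) : ℂ := (Real.cos θ : ℂ) + (Real.sin θ : ℂ) * Complex.I

lemma ee_eq (θ : ℝ) : ee θ = Complex.exp (θ * Complex.I) := by
  rw [Complex.exp_mul_I]; simp [ee]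

lemma ee_ne (θ : ℝ) : ee θ ≠ 0 := by rw [ee_eq]; exact Complex.exp_ne_zero _

lemma norm_ee (θ : ℝ) : ‖ee θ‖ = 1 := by rw [ee_eq]; exact Complex.norm_exp_ofReal_mul_I θ

lemma ee_cont : Continuous ee := by unfold ee; fun_prop

lemma polar_identity (ψ : ℂ → ℂ) (r θ : ℝ) (hr : 0 < r) :
    r • (((r : ℂ) * ee θ)⁻¹ * dbar ψ (r * ee θ)) =
      (1 / 2 : ℂ) * (fderiv ℝ ψ (r * ee θ) (ee θ)) +
      (Complex.I / 2) * (fderiv ℝ ψ (r * ee θ) (Complex.I * ee θ)) := by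
  rw [fderiv_apply_complex, fderiv_apply_complex]
  have hr' : (r : ℂ) ≠ 0 := by exact_mod_cast hr.ne'
  have he := ee_ne θ
  have h1 : (ee θ)⁻¹ = (Real.cos θ : ℂ) - (Real.sin θ : ℂ) * Complex.I := by
    apply inv_eq_of_mul_eq_one_right
    have : (Real.cos θ : ℂ) ^ 2 + (Real.sin θ : ℂ) ^ 2 = 1 := by
      exact_mod_cast Real.cos_sq_add_sin_sq θ
    unfold ee
    linear_combination this - (Real.sin θ : ℂ) ^ 2 * Complex.I_sq
  have hre : (ee θ).re = Real.cos θ := by simp [ee  , -Complex.ofReal_cos, -Complex.ofReal_sin]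
  have him : (ee θ).im = Real.sin θ := by simp [ee  , -Complex.ofReal_cos, -Complex.ofReal_sin]
  have hre' : (Complex.I * ee θ).re = - Real.sin θ := by simp [him]
  have him' : (Complex.I * ee θ).im = Real.cos θ := by simp [hre]
  rw [hre, him, hre', him', mul_inv, h1, dbar]
  rw [Complex.real_smul]
  set a := dX ψ (r * ee θ)
  set b := dY ψ (r * ee θ)
  have : (r : ℂ) * ((r : ℂ)⁻¹ * (↑(Real.cos θ) - ↑(Real.sin θ) * Complex.I) * ((a + Complex.I * b) / 2))
     = (↑(Real.cos θ) - ↑(Real.sin θ) * Complex.I) * ((a + Complex.I * b) / 2) := by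
    field_simp
  rw [this]
  push_cast
  linear_combination (-(Complex.sin θ) * b / 2) * Complex.I_sq

lemma polar_integrable (A : ℝ × ℝ → ℂ) (hA : Continuous A) (R : ℝ)
    (h0 : ∀ p : ℝ × ℝ, R < p.1 → A p = 0) :
    IntegrableOn A (Ioi (0 : ℝ) ×ˢ Ioo (-Real.pi) Real.pi) := by
  have h1 : IntegrableOn A (Icc (0 : ℝ) R ×ˢ Icc (-Real.pi) Real.pi) :=
    hA.continuousOn.integrableOn_compact (isCompact_Icc.prod isCompact_Icc)
  refine h1.of_forall_sdiff_eq_zero (measurableSet_Ioi.prod measurableSet_Ioo) ?_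
  rintro ⟨r, θ⟩ ⟨⟨hr, hθ⟩, h⟩
  apply h0
  simp only [mem_prod, mem_Icc, mem_Ioi, mem_Ioo] at *
  by_contra hc
  exact h ⟨⟨hr.le, not_lt.1 hc⟩, hθ.1.le, hθ.2.le⟩

lemma pompeiu0 (ψ : ℂ → ℂ) (hψ : ContDiff ℝ (⊤ : ℕ∞) ψ) (hc : HasCompactSupport ψ) :
    ∫ u, u⁻¹ * dbar ψ u = - Real.pi * ψ 0 := by
  have hd : Differentiable ℝ ψ := hψ.differentiable (by simp)
  have hfc : Continuous (fderiv ℝ ψ) := hψ.continuous_fderiv (by simp)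
  obtain ⟨R, hR0, hR⟩ : ∃ R : ℝ, 0 < R ∧ tsupport ψ ⊆ Metric.closedBall 0 R := by
    obtain ⟨R, hR0, hR⟩ := hc.isBounded.subset_closedBall_lt 0 0
    exact ⟨R, hR0, hR⟩
  have hfar : ∀ (r θ : ℝ), R < r → (r : ℂ) * ee θ ∉ tsupport ψ := by
    intro r θ hr hm
    have := hR hm
    rw [mem_closedBall_zero_iff, norm_mul, norm_ee, mul_one, Complex.norm_real, Real.norm_eq_abs] at this
    exact absurd (le_trans (le_abs_self r) this) (not_le.2 hr)
  have hfd0 : ∀ (r θ : ℝ), R < r → fderiv ℝ ψ ((r : ℂ) * ee θ) = 0 := by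
    intro r θ hr
    by_contra h
    exact hfar r θ hr (support_fderiv_subset ℝ h)
  rw [← Complex.integral_comp_polarCoord_symm]
  have htar : polarCoord.target = Ioi (0 : ℝ) ×ˢ Ioo (-Real.pi) Real.pi := rfl
  rw [htar]
  set A : ℝ × ℝ → ℂ := fun p => fderiv ℝ ψ (p.1 * ee p.2) (ee p.2) with hAdef
  set B : ℝ × ℝ → ℂ := fun p => fderiv ℝ ψ (p.1 * ee p.2) (Complex.I * ee p.2) with hBdef
  have hec := ee_cont
  have hAc : Continuous A := by
    apply Continuous.clm_apply
    · exact hfc.comp (by fun_prop)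
    · fun_prop
  have hBc : Continuous B := by
    apply Continuous.clm_apply
    · exact hfc.comp (by fun_prop)
    · fun_prop
  have hAi := polar_integrable A hAc R (fun p hp => by simp [hAdef, hfd0 p.1 p.2 hp])
  have hBi := polar_integrable B hBc R (fun p hp => by simp [hBdef, hfd0 p.1 p.2 hp])
  have hstep : ∫ p in Ioi (0 : ℝ) ×ˢ Ioo (-Real.pi) Real.pi,
      p.1 • ((Complex.polarCoord.symm p)⁻¹ * dbar ψ (Complex.polarCoord.symm p)) =
      ∫ p in Ioi (0 : ℝ) ×ˢ Ioo (-Real.pi) Real.pi, ((1 / 2 : ℂ) * A p + (Complex.I / 2) * B p) := by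
    apply setIntegral_congr_fun (measurableSet_Ioi.prod measurableSet_Ioo)
    rintro ⟨r, θ⟩ ⟨hr, hθ⟩
    have := polar_identity ψ r θ hr
    simp only [Complex.polarCoord_symm_apply]
    exact this
  rw [hstep, integral_add (hAi.const_mul _) (hBi.const_mul _), integral_const_mul, integral_const_mul]
  have hBz : ∫ p in Ioi (0 : ℝ) ×ˢ Ioo (-Real.pi) Real.pi, B p = 0 := by
    rw [Measure.volume_eq_prod, setIntegral_prod _ hBi]
    rw [setIntegral_congr_fun (g := fun _ => (0 : ℂ)) measurableSet_Ioi]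
    · simp
    intro r hr
    simp only
    rw [← integral_Ioc_eq_integral_Ioo, ← intervalIntegral.integral_of_le (by linarith [Real.pi_pos])]
    have hder : ∀ θ ∈ uIcc (-Real.pi) Real.pi,
        HasDerivAt (fun θ : ℝ => (r : ℂ)⁻¹ * ψ (r * ee θ)) (B (r, θ)) θ := by
      intro θ _
      have h1 : HasDerivAt (fun θ : ℝ => (r : ℂ) * ee θ) ((r : ℂ) * (Complex.I * ee θ)) θ := by
        have h0 : HasDerivAt ee (Complex.I * ee θ) θ := by
          have : ee = fun θ : ℝ => Complex.exp (θ * Complex.I) := funext ee_eq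
          rw [this]
          have := ((Complex.ofRealCLM.hasDerivAt (x := θ)).mul_const Complex.I).cexp
          refine this.congr_deriv ?_
          simp only [Complex.ofRealCLM_apply, Complex.ofReal_one]
          ring
        exact h0.const_mul _
      have h2 := ((hd ((r : ℂ) * ee θ)).hasFDerivAt.comp_hasDerivAt θ h1).const_mul ((r : ℂ)⁻¹)
      refine h2.congr_deriv ?_
      have : (r : ℂ) * (Complex.I * ee θ) = r • (Complex.I * ee θ) := by simp
      rw [this, map_smul]
      have hr' : (r : ℂ) ≠ 0 := by exact_mod_cast (ne_of_gt hr)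
      simp [hBdef, hr']
    rw [intervalIntegral.integral_eq_sub_of_hasDerivAt hder]
    · simp [ee]
    · exact (hBc.comp (by fun_prop)).intervalIntegrable _ _
  have hAz : ∫ p in Ioi (0 : ℝ) ×ˢ Ioo (-Real.pi) Real.pi, A p = - (2 * Real.pi) * ψ 0 := by
    rw [IntegrableOn, Measure.volume_eq_prod, ← Measure.prod_restrict] at hAi
    rw [Measure.volume_eq_prod, ← Measure.prod_restrict, integral_prod_symm _ hAi]
    have : ∀ θ : ℝ, ∫ r in Ioi (0 : ℝ), A (r, θ) = - ψ 0 := by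
      intro θ
      have hder : ∀ r ∈ Ioi (0 : ℝ), HasDerivAt (fun r : ℝ => ψ (r * ee θ)) (A (r, θ)) r := by
        intro r _
        have h1 : HasDerivAt (fun r : ℝ => (r : ℂ) * ee θ) (ee θ) r := by
          have := (Complex.ofRealCLM.hasDerivAt (x := r)).mul_const (ee θ)
          simpa using this
        exact (hd ((r : ℂ) * ee θ)).hasFDerivAt.comp_hasDerivAt r h1
      have := integral_Ioi_of_hasDerivAt_of_tendsto (a := (0 : ℝ)) (m := (0 : ℂ))
        (f := fun r : ℝ => ψ (r * ee θ)) (f' := fun r => A (r, θ)) ?_ hder ?_ ?_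
      · rw [this]; simp
      · apply Continuous.continuousWithinAt
        exact hψ.continuous.comp (by fun_prop)
      · have h1 : IntegrableOn (fun r => A (r, θ)) (Icc (0 : ℝ) R) :=
          (hAc.comp (by fun_prop : Continuous fun r : ℝ => (r, θ))).continuousOn.integrableOn_compact isCompact_Icc
        refine h1.of_forall_sdiff_eq_zero measurableSet_Ioi ?_
        rintro r ⟨hr, h⟩
        have : R < r := by
          by_contra hh
          exact h ⟨(le_of_lt hr), not_lt.1 hh⟩
        simp [hAdef, hfd0 r θ this]
      · apply tendsto_const_nhds.congr'
        filter_upwards [eventually_gt_atTop R] with r hr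
        exact (image_eq_zero_of_notMem_tsupport (hfar r θ hr)).symm
    simp_rw [this]
    simp
    left
    rw [max_eq_left (by linarith [Real.pi_pos])]
    push_cast; ring
  rw [hBz, hAz]
  ring

end Aux4

namespace Aux4

open Set Filter Topology

/-! ### Calculus of the first order operators -/

lemma contDiff_dX {f : ℂ → ℂ} (hf : ContDiff ℝ (⊤ : ℕ∞) f) : ContDiff ℝ (⊤ : ℕ∞) (dX f) :=
  (hf.fderiv_right (m := (⊤ : ℕ∞)) (by norm_cast)).clm_apply contDiff_const

lemma contDiff_dY {f : ℂ → ℂ} (hf : ContDiff ℝ (⊤ : ℕ∞) f) : ContDiff ℝ (⊤ : ℕ∞) (dY f) :=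
  (hf.fderiv_right (m := (⊤ : ℕ∞)) (by norm_cast)).clm_apply contDiff_const

lemma contDiff_dbar {f : ℂ → ℂ} (hf : ContDiff ℝ (⊤ : ℕ∞) f) : ContDiff ℝ (⊤ : ℕ∞) (dbar f) :=
  ((contDiff_dX hf).add (contDiff_const.mul (contDiff_dY hf))).div_const _

lemma contDiff_dd {f : ℂ → ℂ} (hf : ContDiff ℝ (⊤ : ℕ∞) f) : ContDiff ℝ (⊤ : ℕ∞) (dd f) :=
  ((contDiff_dX hf).sub (contDiff_const.mul (contDiff_dY hf))).div_const _

lemma contDiffAt_dX {f : ℂ → ℂ} {z : ℂ} (hf : ContDiffAt ℝ (⊤ : ℕ∞) f z) :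
    ContDiffAt ℝ (⊤ : ℕ∞) (dX f) z :=
  (hf.fderiv_right (m := (⊤ : ℕ∞)) (by norm_cast)).clm_apply contDiffAt_const

lemma contDiffAt_dY {f : ℂ → ℂ} {z : ℂ} (hf : ContDiffAt ℝ (⊤ : ℕ∞) f z) :
    ContDiffAt ℝ (⊤ : ℕ∞) (dY f) z :=
  (hf.fderiv_right (m := (⊤ : ℕ∞)) (by norm_cast)).clm_apply contDiffAt_const

lemma contDiffAt_dd {f : ℂ → ℂ} {z : ℂ} (hf : ContDiffAt ℝ (⊤ : ℕ∞) f z) :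
    ContDiffAt ℝ (⊤ : ℕ∞) (dd f) z :=
  ((contDiffAt_dX hf).sub (contDiffAt_const.mul (contDiffAt_dY hf))).div_const _

lemma contDiffAt_dbar {f : ℂ → ℂ} {z : ℂ} (hf : ContDiffAt ℝ (⊤ : ℕ∞) f z) :
    ContDiffAt ℝ (⊤ : ℕ∞) (dbar f) z :=
  ((contDiffAt_dX hf).add (contDiffAt_const.mul (contDiffAt_dY hf))).div_const _

lemma dX_zero_of_notMem {f : ℂ → ℂ} {z : ℂ} (h : z ∉ tsupport f) : dX f z = 0 := by
  have : fderiv ℝ f z = 0 := by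
    by_contra h'
    exact h (support_fderiv_subset ℝ h')
  simp [dX, this]

lemma dY_zero_of_notMem {f : ℂ → ℂ} {z : ℂ} (h : z ∉ tsupport f) : dY f z = 0 := by
  have : fderiv ℝ f z = 0 := by
    by_contra h'
    exact h (support_fderiv_subset ℝ h')
  simp [dY, this]

lemma tsupport_dX (f : ℂ → ℂ) : tsupport (dX f) ⊆ tsupport f :=
  closure_minimal (fun z hz => by
    by_contra h
    exact hz (dX_zero_of_notMem h)) (isClosed_tsupport f)

lemma tsupport_dY (f : ℂ → ℂ) : tsupport (dY f) ⊆ tsupport f :=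
  closure_minimal (fun z hz => by
    by_contra h
    exact hz (dY_zero_of_notMem h)) (isClosed_tsupport f)

lemma tsupport_dbar (f : ℂ → ℂ) : tsupport (dbar f) ⊆ tsupport f :=
  closure_minimal (fun z hz => by
    by_contra h
    exact hz (by simp [dbar, dX_zero_of_notMem h, dY_zero_of_notMem h])) (isClosed_tsupport f)

lemma tsupport_dd (f : ℂ → ℂ) : tsupport (dd f) ⊆ tsupport f :=
  closure_minimal (fun z hz => by
    by_contra h
    exact hz (by simp [dd, dX_zero_of_notMem h, dY_zero_of_notMem h])) (isClosed_tsupport f)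

lemma hcs_of_tsupport {f g : ℂ → ℂ} (hf : HasCompactSupport f) (h : tsupport g ⊆ tsupport f) :
    HasCompactSupport g :=
  IsCompact.of_isClosed_subset hf (isClosed_tsupport g) h

lemma dX_mul {f g : ℂ → ℂ} {z : ℂ} (hf : DifferentiableAt ℝ f z) (hg : DifferentiableAt ℝ g z) :
    dX (fun w => f w * g w) z = dX f z * g z + f z * dX g z := by
  simp only [dX]
  rw [fderiv_fun_mul hf hg]
  simp
  ring

lemma dY_mul {f g : ℂ → ℂ} {z : ℂ} (hf : DifferentiableAt ℝ f z) (hg : DifferentiableAt ℝ g z) :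
    dY (fun w => f w * g w) z = dY f z * g z + f z * dY g z := by
  simp only [dY]
  rw [fderiv_fun_mul hf hg]
  simp
  ring

lemma dX_congr {f g : ℂ → ℂ} {z : ℂ} (h : f =ᶠ[𝓝 z] g) : dX f z = dX g z := by
  simp only [dX, h.fderiv_eq]

lemma dY_congr {f g : ℂ → ℂ} {z : ℂ} (h : f =ᶠ[𝓝 z] g) : dY f z = dY g z := by
  simp only [dY, h.fderiv_eq]

lemma dX_dY_comm {f : ℂ → ℂ} {z : ℂ} (hf : ContDiffAt ℝ (⊤ : ℕ∞) f z) :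
    dX (dY f) z = dY (dX f) z := by
  have hsymm : IsSymmSndFDerivAt ℝ f z := hf.isSymmSndFDerivAt (by
    simp only [minSmoothness_of_isRCLikeNormedField]
    exact (show ((2 : ℕ∞) : WithTop ℕ∞) ≤ _ from WithTop.coe_le_coe.2 le_top))
  have hd : DifferentiableAt ℝ (fderiv ℝ f) z :=
    (hf.fderiv_right (m := (⊤ : ℕ∞)) (by norm_cast)).differentiableAt (by simp)
  have h1 : ∀ v w : ℂ, fderiv ℝ (fun y => fderiv ℝ f y v) z w = fderiv ℝ (fderiv ℝ f) z w v := by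
    intro v w
    rw [fderiv_clm_apply hd (differentiableAt_const v)]
    simp
  have h2 := hsymm.eq 1 Complex.I
  have e1 : dX (dY f) z = fderiv ℝ (fun y => fderiv ℝ f y Complex.I) z 1 := rfl
  have e2 : dY (dX f) z = fderiv ℝ (fun y => fderiv ℝ f y 1) z Complex.I := rfl
  rw [e1, e2, h1, h1, h2]

lemma dX_comb {f g : ℂ → ℂ} {z : ℂ} (c : ℂ) (hf : DifferentiableAt ℝ f z)
    (hg : DifferentiableAt ℝ g z) :
    dX (fun w => (f w + c * g w) / 2) z = (dX f z + c * dX g z) / 2 := by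
  have : HasFDerivAt (fun w => (f w + c * g w) * (2⁻¹ : ℂ))
      ((2⁻¹ : ℂ) • (fderiv ℝ f z + c • fderiv ℝ g z)) z :=
    (hf.hasFDerivAt.add (hg.hasFDerivAt.const_mul c)).mul_const _
  simp only [dX, div_eq_mul_inv]
  rw [this.fderiv]
  simp
  ring

lemma dY_comb {f g : ℂ → ℂ} {z : ℂ} (c : ℂ) (hf : DifferentiableAt ℝ f z)
    (hg : DifferentiableAt ℝ g z) :
    dY (fun w => (f w + c * g w) / 2) z = (dY f z + c * dY g z) / 2 := by
  have : HasFDerivAt (fun w => (f w + c * g w) * (2⁻¹ : ℂ))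
      ((2⁻¹ : ℂ) • (fderiv ℝ f z + c • fderiv ℝ g z)) z :=
    (hf.hasFDerivAt.add (hg.hasFDerivAt.const_mul c)).mul_const _
  simp only [dY, div_eq_mul_inv]
  rw [this.fderiv]
  simp
  ring

lemma dd_dbar {f : ℂ → ℂ} {z : ℂ} (hf : ContDiffAt ℝ (⊤ : ℕ∞) f z) :
    4 * dd (dbar f) z = lapC f z := by
  have hx := (contDiffAt_dX hf).differentiableAt (by simp)
  have hy := (contDiffAt_dY hf).differentiableAt (by simp)
  have e1 : dX (dbar f) z = (dX (dX f) z + Complex.I * dX (dY f) z) / 2 := dX_comb _ hx hy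
  have e2 : dY (dbar f) z = (dY (dX f) z + Complex.I * dY (dY f) z) / 2 := dY_comb _ hx hy
  rw [dd, e1, e2, dX_dY_comm hf, lapC]
  linear_combination (-dY (dY f) z) * Complex.I_sq

lemma dbar_dd {f : ℂ → ℂ} {z : ℂ} (hf : ContDiffAt ℝ (⊤ : ℕ∞) f z) :
    4 * dbar (dd f) z = lapC f z := by
  have hx := (contDiffAt_dX hf).differentiableAt (by simp)
  have hy := (contDiffAt_dY hf).differentiableAt (by simp)
  have e0 : dd f = fun w => (dX f w + (-Complex.I) * dY f w) / 2 := by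
    funext w; simp only [dd]; ring
  have e1 : dX (dd f) z = (dX (dX f) z + (-Complex.I) * dX (dY f) z) / 2 := by
    rw [e0]; exact dX_comb _ hx hy
  have e2 : dY (dd f) z = (dY (dX f) z + (-Complex.I) * dY (dY f) z) / 2 := by
    rw [e0]; exact dY_comb _ hx hy
  rw [dbar, e1, e2, dX_dY_comm hf, lapC]
  linear_combination (-dY (dY f) z) * Complex.I_sq

/-! ### The Cauchy kernel -/

noncomputable def kk (w : ℂ) : ℂ := ((Real.pi : ℂ) * w)⁻¹

lemma kk_meas : Measurable kk := by unfold kk; fun_prop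

lemma kk_locInt : LocallyIntegrable kk := by
  apply locallyIntegrable_of_norm_le_rpow (C := Real.pi⁻¹) (α := 1)
  · rw [Complex.finrank_real_complex]; norm_num
  · filter_upwards with x
    rw [Real.rpow_neg_one, kk, norm_inv, norm_mul, mul_inv]
    simp [abs_of_pos Real.pi_pos]
  · exact kk_meas.aestronglyMeasurable
  · rw [Complex.finrank_real_complex]; norm_num

noncomputable def CT (φ : ℂ → ℂ) : ℂ → ℂ :=
  MeasureTheory.convolution kk φ (ContinuousLinearMap.mul ℝ ℂ) volume

lemma CT_smooth {φ : ℂ → ℂ} (hφ : ContDiff ℝ (⊤ : ℕ∞) φ) (hc : HasCompactSupport φ) :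
    ContDiff ℝ (⊤ : ℕ∞) (CT φ) :=
  hc.contDiff_convolution_right _ kk_locInt hφ

lemma CT_apply (φ : ℂ → ℂ) (z : ℂ) : CT φ z = ∫ w, kk (z - w) * φ w := by
  rw [CT, convolution_eq_swap]; rfl

lemma CT_fderiv {φ : ℂ → ℂ} (hφ : ContDiff ℝ (⊤ : ℕ∞) φ) (hc : HasCompactSupport φ) (z v : ℂ) :
    fderiv ℝ (CT φ) z v = ∫ t, kk t * fderiv ℝ φ (z - t) v := by
  have h := hc.hasFDerivAt_convolution_right (ContinuousLinearMap.mul ℝ ℂ) kk_locInt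
    (hφ.of_le (by norm_cast)) z
  rw [CT, h.fderiv]
  rw [convolution_precompR_apply _ kk_locInt (hc.fderiv ℝ) (hφ.continuous_fderiv (by simp))]
  rfl

lemma kk_integrable {η : ℂ → ℂ} (hη : Continuous η) (hc : HasCompactSupport η) (z : ℂ) :
    Integrable (fun t => kk t * η (z - t)) :=
  (hc.convolutionExists_right (ContinuousLinearMap.mul ℝ ℂ) kk_locInt hη z).integrable

lemma CT_dbar {φ : ℂ → ℂ} (hφ : ContDiff ℝ (⊤ : ℕ∞) φ) (hc : HasCompactSupport φ) (z : ℂ) :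
    dbar (CT φ) z = φ z := by
  have i1 := kk_integrable (contDiff_dX hφ).continuous (hcs_of_tsupport hc (tsupport_dX φ)) z
  have i2 := kk_integrable (contDiff_dY hφ).continuous (hcs_of_tsupport hc (tsupport_dY φ)) z
  have h1 : dX (CT φ) z = ∫ t, kk t * dX φ (z - t) := CT_fderiv hφ hc z 1
  have h2 : dY (CT φ) z = ∫ t, kk t * dY φ (z - t) := CT_fderiv hφ hc z Complex.I
  rw [dbar, h1, h2, ← integral_const_mul, ← integral_add i1 (i2.const_mul _), ← integral_div]
  have hψs : ContDiff ℝ (⊤ : ℕ∞) (fun u => φ (z - u)) := hφ.comp (contDiff_const.sub contDiff_id)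
  have hψc : HasCompactSupport (fun u => φ (z - u)) :=
    hc.comp_homeomorph (Homeomorph.subLeft z)
  have hp := pompeiu0 _ hψs hψc
  have hdb : ∀ u, dbar (fun u => φ (z - u)) u = - dbar φ (z - u) := by
    intro u
    have : HasFDerivAt (fun u => φ (z - u)) ((fderiv ℝ φ (z - u)).comp
        (-(ContinuousLinearMap.id ℝ ℂ))) u := by
      apply HasFDerivAt.comp
      · exact (hφ.differentiable (by simp) _).hasFDerivAt
      · exact (hasFDerivAt_id u).const_sub z
    simp only [dbar, dX, dY, this.fderiv]
    simp
    ring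
  simp_rw [hdb] at hp
  have hpi : (Real.pi : ℂ) ≠ 0 := by exact_mod_cast Real.pi_ne_zero
  have : ∀ t, (kk t * dX φ (z - t) + Complex.I * (kk t * dY φ (z - t))) / 2
      = (-(Real.pi : ℂ)⁻¹) * (t⁻¹ * - dbar φ (z - t)) := by
    intro t
    rw [kk, dbar, mul_inv]; ring
  simp_rw [this]
  rw [integral_const_mul, hp]
  simp

end Aux4

namespace Aux4

open Set Filter Topology

lemma contDiff_mul_of_tsupport {u φ : ℂ → ℂ} {U : Set ℂ} (hU : IsOpen U)
    (hu : ContDiffOn ℝ (⊤ : ℕ∞) u U) (hφ : ContDiff ℝ (⊤ : ℕ∞) φ) (hs : tsupport φ ⊆ U) :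
    ContDiff ℝ (⊤ : ℕ∞) (fun z => u z * φ z) := by
  rw [contDiff_iff_contDiffAt]
  intro z
  by_cases hz : z ∈ tsupport φ
  · exact (hu.contDiffAt (hU.mem_nhds (hs hz))).mul hφ.contDiffAt
  · have : (fun z => u z * φ z) =ᶠ[𝓝 z] fun _ => 0 := by
      filter_upwards [notMem_tsupport_iff_eventuallyEq.1 hz] with w hw
      simp [hw]
    exact contDiffAt_const.congr_of_eventuallyEq this

lemma continuous_mul_of_tsupport {u φ : ℂ → ℂ} {U : Set ℂ} (hU : IsOpen U)
    (hu : ContinuousOn u U) (hφ : Continuous φ) (hs : tsupport φ ⊆ U) :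
    Continuous (fun z => u z * φ z) := by
  rw [continuous_iff_continuousAt]
  intro z
  by_cases hz : z ∈ tsupport φ
  · exact (hu.continuousAt (hU.mem_nhds (hs hz))).mul hφ.continuousAt
  · have : (fun z => u z * φ z) =ᶠ[𝓝 z] fun _ => 0 := by
      filter_upwards [notMem_tsupport_iff_eventuallyEq.1 hz] with w hw
      simp [hw]
    exact continuousAt_const.congr this.symm

lemma integrable_mul_of_tsupport {u φ : ℂ → ℂ} {U : Set ℂ} (hU : IsOpen U)
    (hu : ContinuousOn u U) (hφ : Continuous φ) (hc : HasCompactSupport φ) (hs : tsupport φ ⊆ U) :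
    Integrable (fun z => u z * φ z) :=
  (continuous_mul_of_tsupport hU hu hφ hs).integrable_of_hasCompactSupport hc.mul_left

lemma continuousOn_fderiv_apply {u : ℂ → ℂ} {U : Set ℂ} (hU : IsOpen U)
    (hu : ContDiffOn ℝ (⊤ : ℕ∞) u U) (v : ℂ) :
    ContinuousOn (fun z => fderiv ℝ u z v) U := by
  intro z hz
  have h := hu.contDiffAt (hU.mem_nhds hz)
  have h2 : ContDiffAt ℝ (⊤ : ℕ∞) (fun z => fderiv ℝ u z v) z :=
    (h.fderiv_right (m := (⊤ : ℕ∞)) (by norm_cast)).clm_apply contDiffAt_const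
  exact h2.continuousAt.continuousWithinAt

/-- Integration by parts for a function smooth near the support of the test function. -/
lemma ibp_fderiv {u φ : ℂ → ℂ} {U : Set ℂ} (hU : IsOpen U)
    (hu : ContDiffOn ℝ (⊤ : ℕ∞) u U) (hφ : ContDiff ℝ (⊤ : ℕ∞) φ) (hc : HasCompactSupport φ)
    (hs : tsupport φ ⊆ U) (v : ℂ) :
    ∫ z, u z * fderiv ℝ φ z v = - ∫ z, fderiv ℝ u z v * φ z := by
  have hsub : tsupport (fun z => fderiv ℝ φ z v) ⊆ tsupport φ := by
    apply closure_minimal _ (isClosed_tsupport φ)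
    intro z hz
    by_contra h
    apply hz
    have : fderiv ℝ φ z = 0 := by
      by_contra h'
      exact h (support_fderiv_subset ℝ h')
    simp [this]
  apply integral_mul_fderiv_eq_neg_fderiv_mul_of_integrable
  · exact integrable_mul_of_tsupport hU (continuousOn_fderiv_apply hU hu v) hφ.continuous hc hs
  · refine integrable_mul_of_tsupport hU hu.continuousOn ?_ (hcs_of_tsupport hc hsub)
      (hsub.trans hs)
    exact (hφ.continuous_fderiv (by simp)).clm_apply continuous_const
  · exact integrable_mul_of_tsupport hU hu.continuousOn hφ.continuous hc hs
  · intro x hx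
    exact (hu.contDiffAt (hU.mem_nhds (hs hx))).differentiableAt (by simp)
  · intro x _
    exact hφ.differentiable (by simp) x

lemma ibp_dd {u φ : ℂ → ℂ} {U : Set ℂ} (hU : IsOpen U)
    (hu : ContDiffOn ℝ (⊤ : ℕ∞) u U) (hφ : ContDiff ℝ (⊤ : ℕ∞) φ) (hc : HasCompactSupport φ)
    (hs : tsupport φ ⊆ U) :
    ∫ z, u z * dd φ z = - ∫ z, dd u z * φ z := by
  have h1 := ibp_fderiv hU hu hφ hc hs 1
  have h2 := ibp_fderiv hU hu hφ hc hs Complex.I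
  have i1 : Integrable (fun z => u z * dX φ z) :=
    integrable_mul_of_tsupport hU hu.continuousOn (contDiff_dX hφ).continuous
      (hcs_of_tsupport hc (tsupport_dX φ)) ((tsupport_dX φ).trans hs)
  have i2 : Integrable (fun z => u z * dY φ z) :=
    integrable_mul_of_tsupport hU hu.continuousOn (contDiff_dY hφ).continuous
      (hcs_of_tsupport hc (tsupport_dY φ)) ((tsupport_dY φ).trans hs)
  have i3 : Integrable (fun z => dX u z * φ z) :=
    integrable_mul_of_tsupport hU (continuousOn_fderiv_apply hU hu 1) hφ.continuous hc hs
  have i4 : Integrable (fun z => dY u z * φ z) :=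
    integrable_mul_of_tsupport hU (continuousOn_fderiv_apply hU hu Complex.I) hφ.continuous hc hs
  have e1 : ∀ z, u z * dd φ z = (1 / 2) * (u z * dX φ z) - (Complex.I / 2) * (u z * dY φ z) := by
    intro z; simp only [dd]; ring
  have e2 : ∀ z, dd u z * φ z = (1 / 2) * (dX u z * φ z) - (Complex.I / 2) * (dY u z * φ z) := by
    intro z; simp only [dd]; ring
  simp_rw [e1, e2]
  rw [integral_sub (i1.const_mul _) (i2.const_mul _), integral_sub (i3.const_mul _) (i4.const_mul _)]
  simp only [integral_const_mul]
  have h1' : ∫ z, u z * dX φ z = - ∫ z, dX u z * φ z := h1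
  have h2' : ∫ z, u z * dY φ z = - ∫ z, dY u z * φ z := h2
  rw [h1', h2']
  ring

lemma fubini_integrable {F φ : ℂ → ℂ} (hF : Integrable F) (hFc : HasCompactSupport F)
    (hφ : Continuous φ) (hc : HasCompactSupport φ) :
    Integrable (fun p : ℂ × ℂ => F p.1 * kk (p.1 - p.2) * φ p.2) (volume.prod volume) := by
  have hm : AEStronglyMeasurable (fun p : ℂ × ℂ => F p.1 * kk (p.1 - p.2) * φ p.2)
      (volume.prod volume) := by
    refine (hF.aestronglyMeasurable.comp_fst.mul ?_).mul ?_
    · exact (kk_meas.comp (measurable_fst.sub measurable_snd)).aestronglyMeasurable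
    · exact (hφ.comp continuous_snd).aestronglyMeasurable
  rw [integrable_prod_iff hm]
  have hsec : ∀ z, Integrable (fun w => kk (z - w) * φ w) := fun z =>
    (hc.convolutionExists_right (ContinuousLinearMap.mul ℝ ℂ) kk_locInt hφ z).integrable_swap
  constructor
  · filter_upwards with z
    have := (hsec z).const_mul (F z)
    simpa [mul_assoc] using this
  · set J : ℂ → ℝ := fun z => ∫ w, ‖kk (z - w)‖ * ‖φ w‖ with hJ
    have hJc : Continuous J := by
      have h := hc.norm.continuous_convolution_right (ContinuousLinearMap.mul ℝ ℝ)
        (fun x => let ⟨s, hs, h⟩ := kk_locInt x; ⟨s, hs, h.norm⟩ :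
          LocallyIntegrable (fun z => ‖kk z‖) volume)
        hφ.norm
      have e : J = MeasureTheory.convolution (fun z => ‖kk z‖) (fun z => ‖φ z‖)
          (ContinuousLinearMap.mul ℝ ℝ) volume := by
        funext z
        rw [convolution_eq_swap]; rfl
      rw [e]; exact h
    obtain ⟨C, hC⟩ := hFc.exists_bound_of_continuousOn hJc.continuousOn
    have e : ∀ z, ∫ w, ‖F z * kk (z - w) * φ w‖ = ‖F z‖ * J z := by
      intro z
      rw [hJ, ← integral_const_mul]
      simp [mul_assoc]
    simp only [e]
    refine Integrable.mono' (hF.norm.const_mul C)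
      (hF.norm.aestronglyMeasurable.mul hJc.aestronglyMeasurable) ?_
    filter_upwards with z
    by_cases hz : z ∈ tsupport F
    · rw [norm_mul, norm_norm, mul_comm]
      exact mul_le_mul_of_nonneg_right (hC z hz) (norm_nonneg _)
    · simp [image_eq_zero_of_notMem_tsupport hz]

/-- The key lemma: an integrable function, smooth off a point, whose distributional Laplacian is
a Dirac mass plus an integrable function, has an integrable gradient off the point, and this is
the distributional gradient. -/
lemma weak_deriv {g F : ℂ → ℂ} {p : ℂ}
    (hgs : ContDiffOn ℝ (⊤ : ℕ∞) g {p}ᶜ) 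
    (hF : Integrable F) (hFc : HasCompactSupport F)
    (hdist : ∀ ψ : ℂ → ℂ, ContDiff ℝ (⊤ : ℕ∞) ψ → ∫ z, g z * lapC ψ z = ψ p + ∫ z, F z * ψ z)
    {φ : ℂ → ℂ} (hφ : ContDiff ℝ (⊤ : ℕ∞) φ) (hc : HasCompactSupport φ) :
    Integrable (fun z => dd g z * φ z) ∧ ∫ z, g z * dd φ z = - ∫ z, dd g z * φ z := by
  have hU : IsOpen ({p}ᶜ : Set ℂ) := isOpen_compl_singleton
  set H : ℂ → ℂ := fun w => kk (p - w) + ∫ z, F z * kk (z - w) with hH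
  have main : ∀ φ : ℂ → ℂ, ContDiff ℝ (⊤ : ℕ∞) φ → HasCompactSupport φ →
      Integrable (fun w => H w * φ w) ∧ 4 * ∫ z, g z * dd φ z = ∫ w, H w * φ w := by
    intro φ hφ hc
    have hfub := fubini_integrable hF hFc hφ.continuous hc
    have i1 : Integrable (fun w => kk (p - w) * φ w) :=
      (hc.convolutionExists_right (ContinuousLinearMap.mul ℝ ℂ) kk_locInt hφ.continuous
        p).integrable_swap
    have i2 : Integrable (fun w => (∫ z, F z * kk (z - w)) * φ w) := by
      have := hfub.integral_prod_right
      simpa only [integral_mul_const] using this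
    have e : ∀ w, H w * φ w = kk (p - w) * φ w + (∫ z, F z * kk (z - w)) * φ w := by
      intro w; rw [hH]; ring
    refine ⟨by simp only [e]; exact i1.add i2, ?_⟩
    simp only [e]
    rw [integral_add i1 i2]
    have hd := hdist (CT φ) (CT_smooth hφ hc)
    have hlap : ∀ z, lapC (CT φ) z = 4 * dd φ z := by
      intro z
      rw [← dd_dbar (CT_smooth hφ hc).contDiffAt]
      have : dbar (CT φ) = φ := funext (CT_dbar hφ hc)
      rw [this]
    have h1 : ∫ z, g z * lapC (CT φ) z = 4 * ∫ z, g z * dd φ z := by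
      rw [← integral_const_mul]
      congr 1; funext z; rw [hlap]; ring
    rw [← h1, hd, CT_apply]
    congr 1
    have hs := integral_integral_swap (f := fun z w => F z * kk (z - w) * φ w) hfub
    simp only [integral_mul_const] at hs
    rw [← hs]
    congr 1; funext z
    rw [CT_apply, ← integral_const_mul]
    congr 1; funext w; ring
  have hHloc : LocallyIntegrable H := by
    intro x
    let b : ContDiffBump x := ⟨1, 2, by norm_num, by norm_num⟩
    have hb := (main (fun z => ((b z : ℝ) : ℂ))
      (Complex.ofRealCLM.contDiff.comp b.contDiff)
      (b.hasCompactSupport.comp_left (g := fun r : ℝ => (r : ℂ)) (by simp))).1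
    refine ⟨Metric.ball x 1, Metric.ball_mem_nhds x one_pos, ?_⟩
    refine (hb.integrableOn (s := Metric.ball x 1)).congr_fun ?_ Metric.isOpen_ball.measurableSet
    intro z hz
    have : b z = 1 := b.one_of_mem_closedBall (Metric.ball_subset_closedBall hz)
    simp [this]
  have hddc : ContinuousOn (dd g) {p}ᶜ := by
    intro z hz
    exact (contDiffAt_dd (hgs.contDiffAt (hU.mem_nhds hz))).continuousAt.continuousWithinAt
  have hae : ∀ᵐ z, z ∈ ({p}ᶜ : Set ℂ) → H z + 4 * dd g z = 0 := by
    refine hU.ae_eq_zero_of_integral_contDiff_smul_eq_zero (f := fun z => H z + 4 * dd g z) ?_ ?_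
    · refine (hHloc.locallyIntegrableOn _).add ?_
      exact (continuousOn_const.mul hddc).locallyIntegrableOn hU.measurableSet
    · intro η hη hηc hηs
      have hφ : ContDiff ℝ (⊤ : ℕ∞) (fun z => ((η z : ℝ) : ℂ)) := Complex.ofRealCLM.contDiff.comp hη
      have hφc : HasCompactSupport (fun z => ((η z : ℝ) : ℂ)) :=
        hηc.comp_left (g := fun r : ℝ => (r : ℂ)) (by simp)
      have hφs : tsupport (fun z => ((η z : ℝ) : ℂ)) ⊆ {p}ᶜ :=
        (tsupport_comp_subset (g := fun r : ℝ => (r : ℂ)) (by simp) η).trans hηs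
      obtain ⟨j1, j2⟩ := main _ hφ hφc
      have j3 := ibp_dd hU hgs hφ hφc hφs
      have j4 := integrable_mul_of_tsupport hU hddc hφ.continuous hφc hφs
      have e : ∀ z, η z • (H z + 4 * dd g z) = H z * (η z : ℂ) + 4 * (dd g z * (η z : ℂ)) := by
        intro z; rw [Complex.real_smul]; ring
      simp only [e]
      rw [integral_add j1 (j4.const_mul _), integral_const_mul, ← j2, j3]
      ring
  have hae' : ∀ᵐ z : ℂ, dd g z * φ z = (-(1 / 4) : ℂ) * (H z * φ z) := by
    have hp : ∀ᵐ z : ℂ, z ≠ p := by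
      simp [ae_iff]
    filter_upwards [hae, hp] with z hz hzp
    have := hz hzp
    linear_combination (1 / 4) * φ z * this
  obtain ⟨j1, j2⟩ := main φ hφ hc
  refine ⟨(j1.const_mul _).congr (hae'.mono fun z hz => hz.symm), ?_⟩
  rw [integral_congr_ae hae', integral_const_mul, ← j2]
  ring

end Aux4

namespace Aux4

open Set Filter Topology

lemma lap_congr {f g : ℂ → ℂ} {z : ℂ} (h : f =ᶠ[𝓝 z] g) : lapC f z = lapC g z := by
  have h1 : dX f =ᶠ[𝓝 z] dX g := h.eventuallyEq_nhds.mono fun w hw => dX_congr hw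
  have h2 : dY f =ᶠ[𝓝 z] dY g := h.eventuallyEq_nhds.mono fun w hw => dY_congr hw
  rw [lapC, lapC, dX_congr h1, dY_congr h2]

noncomputable def qq (p z : ℂ) : ℂ := 1 + (((z - p).re : ℝ) : ℂ) ^ 2

lemma qq_smooth (p : ℂ) : ContDiff ℝ (⊤ : ℕ∞) (qq p) := by
  have h : ContDiff ℝ (⊤ : ℕ∞) (fun z : ℂ => (((z - p).re : ℝ) : ℂ)) :=
    Complex.ofRealCLM.contDiff.comp (Complex.reCLM.contDiff.comp (contDiff_id.sub contDiff_const))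
  exact contDiff_const.add (h.pow 2)

lemma lap_qq (p z : ℂ) : lapC (qq p) z = 2 := by
  have hl : ∀ z : ℂ, HasFDerivAt (fun z : ℂ => (((z - p).re : ℝ) : ℂ))
      (Complex.ofRealCLM.comp Complex.reCLM) z := by
    intro z
    have := (Complex.ofRealCLM.comp Complex.reCLM).hasFDerivAt (x := z - p)
    exact this.comp z ((hasFDerivAt_id z).sub_const p)
  have hq : ∀ z v : ℂ, fderiv ℝ (qq p) z v = 2 * ((z - p).re : ℂ) * (v.re : ℂ) := by
    intro z v
    have h1 : HasFDerivAt (qq p) _ z := ((hl z).pow 2).const_add 1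
    rw [h1.fderiv]
    simp
  have hx : dX (qq p) = fun z => 2 * (((z - p).re : ℝ) : ℂ) := by
    funext z; simp [dX, hq]
  have hy : dY (qq p) = fun z => 0 := by
    funext z; simp [dY, hq]
  rw [lapC, hx, hy]
  have h2 := (hl z).const_mul (2 : ℂ)
  simp only [dX, dY]
  rw [h2.fderiv]
  simp

lemma G_int {Ω : Set ℂ} (hΩ : IsOpen Ω) {p : ℂ} (hp : p ∈ Ω) {Gc N : ℂ → ℂ}
    (hdist : ∀ φ : ℂ → ℂ, ContDiff ℝ (⊤ : ℕ∞) φ → HasCompactSupport φ → tsupport φ ⊆ Ω →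
      ∫ z, Gc z * lapC φ z = (∫ z, N z * Gc z * φ z) + φ p) :
    IntegrableAtFilter Gc (𝓝 p) := by
  by_contra hnot
  obtain ⟨R, hR0, hR⟩ := Metric.isOpen_iff.1 hΩ p hp
  let b0 : ContDiffBump p := ⟨R / 4, R / 2, by positivity, by linarith⟩
  set φ0 : ℂ → ℂ := fun z => ((b0 z : ℝ) : ℂ) * qq p z with hφ0
  have hbs : ∀ b : ContDiffBump p, ContDiff ℝ (⊤ : ℕ∞) (fun z => ((b z : ℝ) : ℂ)) :=
    fun b => Complex.ofRealCLM.contDiff.comp b.contDiff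
  have hb0c : HasCompactSupport (fun z => ((b0 z : ℝ) : ℂ)) :=
    b0.hasCompactSupport.comp_left (g := fun r : ℝ => (r : ℂ)) (by simp)
  have hφ0s : ContDiff ℝ (⊤ : ℕ∞) φ0 := (hbs b0).mul (qq_smooth p)
  have hφ0c : HasCompactSupport φ0 := hb0c.mul_right
  have hφ0t : tsupport φ0 ⊆ Ω := by
    refine (tsupport_mul_subset_left (f := fun z => ((b0 z : ℝ) : ℂ))).trans ?_
    refine (tsupport_comp_subset (g := fun r : ℝ => (r : ℂ)) (by simp) b0).trans ?_
    rw [b0.tsupport_eq]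
    refine (Metric.closedBall_subset_ball ?_).trans hR
    change R / 2 < R
    linarith
  have key : ∀ b : ContDiffBump p, ∫ z, N z * Gc z * (((b z : ℝ) : ℂ) * φ0 z) = -1 := by
    intro b
    have hs : ContDiff ℝ (⊤ : ℕ∞) (fun z => ((b z : ℝ) : ℂ) * φ0 z) := (hbs b).mul hφ0s
    have hc : HasCompactSupport (fun z => ((b z : ℝ) : ℂ) * φ0 z) := hφ0c.mul_left
    have ht : tsupport (fun z => ((b z : ℝ) : ℂ) * φ0 z) ⊆ Ω :=
      (tsupport_mul_subset_right (f := fun z => ((b z : ℝ) : ℂ))).trans hφ0t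
    have h := hdist _ hs hc ht
    have hev : (fun z => ((b z : ℝ) : ℂ) * φ0 z) =ᶠ[𝓝 p] qq p := by
      filter_upwards [b.eventuallyEq_one, b0.eventuallyEq_one] with z h1 h2
      simp [hφ0, h1, h2]
    have hp1 : ((b p : ℝ) : ℂ) * φ0 p = 1 := by
      have := hev.eq_of_nhds
      rw [this]; simp [qq]
    have hni : ¬ Integrable (fun z => Gc z * lapC (fun z => ((b z : ℝ) : ℂ) * φ0 z) z) := by
      intro hi
      apply hnot
      have hev2 : ∀ᶠ z in 𝓝 p, lapC (fun z => ((b z : ℝ) : ℂ) * φ0 z) z = 2 :=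
        hev.eventuallyEq_nhds.mono fun w hw => by rw [lap_congr hw, lap_qq]
      obtain ⟨U, hU, hUo, hpU⟩ := mem_nhds_iff.1 hev2
      refine ⟨U, hUo.mem_nhds hpU, ?_⟩
      refine ((hi.const_mul (1 / 2 : ℂ)).integrableOn (s := U)).congr_fun ?_ hUo.measurableSet
      intro z hz
      have : lapC (fun z => ((b z : ℝ) : ℂ) * φ0 z) z = 2 := hU hz
      simp only [this]
      ring
    rw [integral_undef hni, hp1] at h
    linear_combination -h
  have hbnd : Integrable (fun z => N z * Gc z * φ0 z * ((b0 z : ℝ) : ℂ)) := by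
    by_contra hni
    have h := key b0
    have e : (fun z => N z * Gc z * (((b0 z : ℝ) : ℂ) * φ0 z))
      = (fun z => N z * Gc z * φ0 z * ((b0 z : ℝ) : ℂ)) := by funext z; ring
    rw [e, integral_undef hni] at h
    norm_num at h
  -- a sequence of shrinking bumps
  let b : ℕ → ContDiffBump p := fun n =>
    ⟨R / 8 / (n + 1), R / 4 / (n + 1), by positivity, by gcongr; linarith⟩
  have hrout : ∀ n, (b n).rOut = R / 4 / (n + 1) := fun n => rfl
  have hbb : ∀ n z, b n z ≠ 0 → b0 z = 1 := by
    intro n z hz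
    apply b0.one_of_mem_closedBall
    have : z ∈ Function.support (b n) := hz
    rw [(b n).support_eq, hrout] at this
    have h4 : b0.rIn = R / 4 := rfl
    rw [h4]
    refine Metric.ball_subset_closedBall (Metric.ball_subset_ball ?_ this)
    apply div_le_self (by positivity)
    have : (0 : ℝ) ≤ n := Nat.cast_nonneg n
    linarith
  have hprod : ∀ n z, N z * Gc z * (((b n z : ℝ) : ℂ) * φ0 z) =
      ((b n z : ℝ) : ℂ) * (N z * Gc z * φ0 z * ((b0 z : ℝ) : ℂ)) := by
    intro n z
    by_cases h : b n z = 0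
    · simp [h]
    · rw [hbb n z h]; push_cast; ring
  have hlim : Tendsto (fun n => ∫ z, N z * Gc z * (((b n z : ℝ) : ℂ) * φ0 z)) atTop
      (𝓝 (∫ _ : ℂ, (0 : ℂ))) := by
    simp only [hprod]
    refine tendsto_integral_of_dominated_convergence
      (fun z => ‖N z * Gc z * φ0 z * ((b0 z : ℝ) : ℂ)‖) ?_ hbnd.norm ?_ ?_
    · intro n
      exact (hbs (b n)).continuous.aestronglyMeasurable.mul hbnd.aestronglyMeasurable
    · intro n
      filter_upwards with z
      rw [norm_mul]
      refine mul_le_of_le_one_left (norm_nonneg _) ?_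
      rw [Complex.norm_real, Real.norm_eq_abs, abs_of_nonneg (b n).nonneg]
      exact (b n).le_one
    · have hpz : ∀ᵐ z : ℂ, z ≠ p := by simp [ae_iff]
      filter_upwards [hpz] with z hz
      have hd : 0 < dist z p := dist_pos.2 hz
      have ht : Tendsto (fun n : ℕ => R / 4 / ((n : ℝ) + 1)) atTop (𝓝 0) :=
        tendsto_const_nhds.div_atTop (tendsto_natCast_atTop_atTop.atTop_add tendsto_const_nhds)
      apply tendsto_const_nhds.congr'
      filter_upwards [ht.eventually (gt_mem_nhds hd)] with n hn
      have : b n z = 0 := (b n).zero_of_le_dist (by rw [hrout]; exact hn.le)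
      simp [this]
  simp only [key] at hlim
  have := tendsto_nhds_unique hlim tendsto_const_nhds
  simp at this

end Aux4

namespace Aux4

open Set Filter Topology
open scoped Manifold ContDiff

lemma exists_cutoff {K Ω : Set ℂ} (hK : IsCompact K) (hΩ : IsOpen Ω) (h : K ⊆ Ω) :
    ∃ χ : ℂ → ℂ, ContDiff ℝ (⊤ : ℕ∞) χ ∧ HasCompactSupport χ ∧ tsupport χ ⊆ Ω ∧
      ∀ z ∈ K, χ =ᶠ[𝓝 z] fun _ => 1 := by
  obtain ⟨L, hL, hKL, hLΩ⟩ := exists_compact_between hK hΩ h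
  obtain ⟨f, hf1, hf0, -⟩ := exists_contMDiffMap_one_nhds_of_subset_interior (n := (⊤ : ℕ∞)) 𝓘(ℝ, ℂ)
    hK.isClosed hKL
  have hfs : ContDiff ℝ (⊤ : ℕ∞) (f : ℂ → ℝ) := f.contMDiff.contDiff
  have ht : tsupport (fun z => ((f z : ℝ) : ℂ)) ⊆ L := by
    apply closure_minimal _ hL.isClosed
    intro z hz
    by_contra hzL
    exact hz (by simp [hf0 z hzL])
  refine ⟨fun z => ((f z : ℝ) : ℂ), Complex.ofRealCLM.contDiff.comp hfs,
    IsCompact.of_isClosed_subset hL (isClosed_tsupport _) ht, ht.trans hLΩ, ?_⟩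
  intro z hz
  have := (eventually_nhdsSet_iff_forall.1 hf1) z hz
  filter_upwards [this] with w hw
  simp [hw]

lemma lap_mul {f g : ℂ → ℂ} (hf : ContDiff ℝ (⊤ : ℕ∞) f) (hg : ContDiff ℝ (⊤ : ℕ∞) g) (z : ℂ) :
    lapC (fun w => f w * g w) z =
      f z * lapC g z + 2 * (dX f z * dX g z + dY f z * dY g z) + g z * lapC f z := by
  have df := hf.differentiable (by simp)
  have dg := hg.differentiable (by simp)
  have dfx := (contDiff_dX hf).differentiable (by simp)
  have dgx := (contDiff_dX hg).differentiable (by simp)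
  have dfy := (contDiff_dY hf).differentiable (by simp)
  have dgy := (contDiff_dY hg).differentiable (by simp)
  have ex : dX (fun w => f w * g w) = fun w => dX f w * g w + f w * dX g w :=
    funext fun w => dX_mul (df w) (dg w)
  have ey : dY (fun w => f w * g w) = fun w => dY f w * g w + f w * dY g w :=
    funext fun w => dY_mul (df w) (dg w)
  have ex2 : dX (fun w => dX f w * g w + f w * dX g w) z
      = dX (fun w => dX f w * g w) z + dX (fun w => f w * dX g w) z := by
    have h1 : DifferentiableAt ℝ (fun w => dX f w * g w) z := (dfx z).mul (dg z)
    have h2 : DifferentiableAt ℝ (fun w => f w * dX g w) z := (df z).mul (dgx z)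
    rw [dX, fderiv_fun_add h1 h2]; rfl
  have ey2 : dY (fun w => dY f w * g w + f w * dY g w) z
      = dY (fun w => dY f w * g w) z + dY (fun w => f w * dY g w) z := by
    have h1 : DifferentiableAt ℝ (fun w => dY f w * g w) z := (dfy z).mul (dg z)
    have h2 : DifferentiableAt ℝ (fun w => f w * dY g w) z := (df z).mul (dgy z)
    rw [dY, fderiv_fun_add h1 h2]; rfl
  rw [lapC, ex, ey, ex2, ey2, dX_mul (dfx z) (dg z), dX_mul (df z) (dgx z),
    dY_mul (dfy z) (dg z), dY_mul (df z) (dgy z), lapC, lapC]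
  ring

lemma contDiff_lapC {f : ℂ → ℂ} (hf : ContDiff ℝ (⊤ : ℕ∞) f) : ContDiff ℝ (⊤ : ℕ∞) (lapC f) :=
  (contDiff_dX (contDiff_dX hf)).add (contDiff_dY (contDiff_dY hf))

lemma tsupport_lapC (f : ℂ → ℂ) : tsupport (lapC f) ⊆ tsupport f :=
  closure_minimal (fun z hz => by
    by_contra h
    apply hz
    rw [lapC, dX_zero_of_notMem (fun h' => h (tsupport_dX f h')),
      dY_zero_of_notMem (fun h' => h (tsupport_dY f h')), add_zero]) (isClosed_tsupport f)

lemma int4a {a b c d : ℂ → ℂ} (ia : Integrable a) (ib : Integrable b) (ic : Integrable c)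
    (id : Integrable d) : ∫ z, (a z - 2 * b z - 2 * c z - d z)
      = (∫ z, a z) - 2 * (∫ z, b z) - 2 * (∫ z, c z) - ∫ z, d z := by
  have i1 : Integrable (fun z => a z - 2 * b z) := ia.sub (ib.const_mul 2)
  have i2 : Integrable (fun z => a z - 2 * b z - 2 * c z) := i1.sub (ic.const_mul 2)
  rw [integral_sub i2 id, integral_sub i1 (ic.const_mul 2), integral_sub ia (ib.const_mul 2)]
  simp only [integral_const_mul]

lemma int4b {a b c d : ℂ → ℂ} (ia : Integrable a) (ib : Integrable b) (ic : Integrable c)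
    (id : Integrable d) : ∫ z, (a z + 2 * b z + 2 * c z - d z)
      = (∫ z, a z) + 2 * (∫ z, b z) + 2 * (∫ z, c z) - ∫ z, d z := by
  have i1 : Integrable (fun z => a z + 2 * b z) := ia.add (ib.const_mul 2)
  have i2 : Integrable (fun z => a z + 2 * b z + 2 * c z) := i1.add (ic.const_mul 2)
  rw [integral_sub i2 id, integral_add i1 (ic.const_mul 2), integral_add ia (ib.const_mul 2)]
  simp only [integral_const_mul]

section core

variable {Ω : Set ℂ} {p : ℂ} {Gc N : ℂ → ℂ}

lemma G_mul_int (hΩ : IsOpen Ω) (hp : p ∈ Ω)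
    (hs : ContDiffOn ℝ (⊤ : ℕ∞) Gc (Ω \ {p}))
    (hdist : ∀ φ : ℂ → ℂ, ContDiff ℝ (⊤ : ℕ∞) φ → HasCompactSupport φ → tsupport φ ⊆ Ω →
      ∫ z, Gc z * lapC φ z = (∫ z, N z * Gc z * φ z) + φ p)
    {φ : ℂ → ℂ} (hφ : Continuous φ) (hc : HasCompactSupport φ) (ht : tsupport φ ⊆ Ω) :
    Integrable (fun z => Gc z * φ z) := by
  have hU : IsOpen (Ω \ {p}) := hΩ.sdiff isClosed_singleton
  have hloc : LocallyIntegrableOn Gc Ω := by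
    intro x hx
    by_cases hxp : x = p
    · subst hxp
      exact (G_int hΩ hp hdist).filter_mono nhdsWithin_le_nhds
    · have h1 : LocallyIntegrableOn Gc (Ω \ {p}) :=
        hs.continuousOn.locallyIntegrableOn hU.measurableSet
      have h2 := h1 x ⟨hx, hxp⟩
      rw [hU.nhdsWithin_eq ⟨hx, hxp⟩] at h2
      exact h2.filter_mono nhdsWithin_le_nhds
  have h1 := hloc.integrableOn_compact_subset ht hc
  have h2 : IntegrableOn (fun z => Gc z * φ z) (tsupport φ) :=
    h1.mul_continuousOn hφ.continuousOn hc
  rwa [integrableOn_iff_integrable_of_support_subset] at h2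
  intro z hz
  apply subset_tsupport
  intro h0
  exact hz (by simp [h0])

lemma core_dd (hΩ : IsOpen Ω) (hp : p ∈ Ω)
    (hs : ContDiffOn ℝ (⊤ : ℕ∞) Gc (Ω \ {p})) (hN : Continuous N)
    (hdist : ∀ φ : ℂ → ℂ, ContDiff ℝ (⊤ : ℕ∞) φ → HasCompactSupport φ → tsupport φ ⊆ Ω →
      ∫ z, Gc z * lapC φ z = (∫ z, N z * Gc z * φ z) + φ p)
    {φ : ℂ → ℂ} (hφ : ContDiff ℝ (⊤ : ℕ∞) φ) (hc : HasCompactSupport φ) (ht : tsupport φ ⊆ Ω) :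
    Integrable (fun z => dd Gc z * φ z) ∧ ∫ z, Gc z * dd φ z = - ∫ z, dd Gc z * φ z := by
  have hU : IsOpen (Ω \ {p}) := hΩ.sdiff isClosed_singleton
  obtain ⟨χ, hχs, hχc, hχt, hχ1⟩ := exists_cutoff (K := tsupport φ ∪ {p})
    (IsCompact.union hc isCompact_singleton) hΩ (union_subset ht (by simpa using hp))
  have hχp := hχ1 p (by simp)
  have hGint : ∀ {φ : ℂ → ℂ}, Continuous φ → HasCompactSupport φ → tsupport φ ⊆ Ω →
      Integrable (fun z => Gc z * φ z) := fun h1 h2 h3 => G_mul_int hΩ hp hs hdist h1 h2 h3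
  -- the derivatives of the cutoff vanish near `p`
  have hχx : tsupport (dX χ) ⊆ Ω \ {p} := by
    refine fun z hz => ⟨hχt (tsupport_dX χ hz), ?_⟩
    rintro rfl
    revert hz
    rw [imp_false, notMem_tsupport_iff_eventuallyEq]
    filter_upwards [hχp.eventuallyEq_nhds] with w hw
    rw [dX_congr hw]; simp [dX]
  have hχy : tsupport (dY χ) ⊆ Ω \ {p} := by
    refine fun z hz => ⟨hχt (tsupport_dY χ hz), ?_⟩
    rintro rfl
    revert hz
    rw [imp_false, notMem_tsupport_iff_eventuallyEq]
    filter_upwards [hχp.eventuallyEq_nhds] with w hw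
    rw [dY_congr hw]; simp [dY]
  set P : ℂ → ℂ := fun z => Gc z * dX χ z with hP
  set Q : ℂ → ℂ := fun z => Gc z * dY χ z with hQ
  have hPs : ContDiff ℝ (⊤ : ℕ∞) P := contDiff_mul_of_tsupport hU hs (contDiff_dX hχs) hχx
  have hQs : ContDiff ℝ (⊤ : ℕ∞) Q := contDiff_mul_of_tsupport hU hs (contDiff_dY hχs) hχy
  have hPt : tsupport P ⊆ tsupport χ :=
    (tsupport_mul_subset_right (f := Gc)).trans (tsupport_dX χ)
  have hQt : tsupport Q ⊆ tsupport χ :=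
    (tsupport_mul_subset_right (f := Gc)).trans (tsupport_dY χ)
  have hPc := hcs_of_tsupport hχc hPt
  have hQc := hcs_of_tsupport hχc hQt
  set F1 : ℂ → ℂ := fun z => Gc z * (N z * χ z) with hF1
  set F2 : ℂ → ℂ := dX P with hF2
  set F3 : ℂ → ℂ := dY Q with hF3
  set F4 : ℂ → ℂ := fun z => Gc z * lapC χ z with hF4
  have hNχt : tsupport (fun z => N z * χ z) ⊆ tsupport χ := tsupport_mul_subset_right (f := N)
  have i1 : Integrable F1 := hGint (hN.mul hχs.continuous) hχc.mul_left (hNχt.trans hχt)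
  have i2 : Integrable F2 := (contDiff_dX hPs).continuous.integrable_of_hasCompactSupport
    (hcs_of_tsupport hPc (tsupport_dX P))
  have i3 : Integrable F3 := (contDiff_dY hQs).continuous.integrable_of_hasCompactSupport
    (hcs_of_tsupport hQc (tsupport_dY Q))
  have i4 : Integrable F4 := hGint (contDiff_lapC hχs).continuous
    (hcs_of_tsupport hχc (tsupport_lapC χ)) ((tsupport_lapC χ).trans hχt)
  set F : ℂ → ℂ := fun z => F1 z + 2 * F2 z + 2 * F3 z - F4 z with hF
  have iF : Integrable F := ((i1.add (i2.const_mul 2)).add (i3.const_mul 2)).sub i4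
  have hFc : HasCompactSupport F := by
    refine HasCompactSupport.intro hχc fun z hz => ?_
    have e1 : F1 z = 0 := by simp [hF1, image_eq_zero_of_notMem_tsupport hz]
    have e2 : F2 z = 0 := dX_zero_of_notMem fun h => hz (hPt h)
    have e3 : F3 z = 0 := dY_zero_of_notMem fun h => hz (hQt h)
    have e4 : F4 z = 0 := by
      simp [hF4, image_eq_zero_of_notMem_tsupport (fun h => hz (tsupport_lapC χ h))]
    simp [hF, e1, e2, e3, e4]
  have hgs : ContDiffOn ℝ (⊤ : ℕ∞) (fun z => Gc z * χ z) {p}ᶜ := by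
    intro z hz
    apply ContDiffAt.contDiffWithinAt
    by_cases hzt : z ∈ tsupport χ
    · exact (hs.contDiffAt (hU.mem_nhds ⟨hχt hzt, hz⟩)).mul hχs.contDiffAt
    · have : (fun z => Gc z * χ z) =ᶠ[𝓝 z] fun _ => 0 := by
        filter_upwards [notMem_tsupport_iff_eventuallyEq.1 hzt] with w hw
        simp [hw]
      exact contDiffAt_const.congr_of_eventuallyEq this
  have hd : ∀ ψ : ℂ → ℂ, ContDiff ℝ (⊤ : ℕ∞) ψ →
      ∫ z, (Gc z * χ z) * lapC ψ z = ψ p + ∫ z, F z * ψ z := by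
    intro ψ hψ
    have hχψt : tsupport (fun z => χ z * ψ z) ⊆ tsupport χ :=
      tsupport_mul_subset_left (f := χ)
    have h0 := hdist (fun z => χ z * ψ z) (hχs.mul hψ) hχc.mul_right (hχψt.trans hχt)
    have j0 : Integrable (fun z => Gc z * lapC (fun w => χ w * ψ w) z) :=
      hGint (contDiff_lapC (hχs.mul hψ)).continuous
        (hcs_of_tsupport hχc ((tsupport_lapC _).trans hχψt))
        (((tsupport_lapC _).trans hχψt).trans hχt)
    have j1 : Integrable (fun z => F1 z * ψ z) := by
      have : tsupport (fun z => (N z * χ z) * ψ z) ⊆ tsupport χ :=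
        (tsupport_mul_subset_left (f := fun z => N z * χ z)).trans hNχt
      have := hGint ((hN.mul hχs.continuous).mul hψ.continuous) (hcs_of_tsupport hχc this)
        (this.trans hχt)
      refine this.congr ?_
      filter_upwards with z
      simp only [hF1, Pi.mul_apply]; ring
    have j2 : Integrable (fun z => F2 z * ψ z) :=
      ((contDiff_dX hPs).mul hψ).continuous.integrable_of_hasCompactSupport
        (hcs_of_tsupport hPc (tsupport_dX P)).mul_right
    have j3 : Integrable (fun z => F3 z * ψ z) :=
      ((contDiff_dY hQs).mul hψ).continuous.integrable_of_hasCompactSupport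
        (hcs_of_tsupport hQc (tsupport_dY Q)).mul_right
    have j4 : Integrable (fun z => F4 z * ψ z) := by
      have : tsupport (fun z => lapC χ z * ψ z) ⊆ tsupport χ :=
        (tsupport_mul_subset_left (f := lapC χ)).trans (tsupport_lapC χ)
      have := hGint ((contDiff_lapC hχs).mul hψ).continuous (hcs_of_tsupport hχc this)
        (this.trans hχt)
      refine this.congr ?_
      filter_upwards with z
      simp only [hF4]; ring
    have j5 : Integrable (fun z => P z * dX ψ z) :=
      (hPs.mul (contDiff_dX hψ)).continuous.integrable_of_hasCompactSupport hPc.mul_right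
    have j6 : Integrable (fun z => Q z * dY ψ z) :=
      (hQs.mul (contDiff_dY hψ)).continuous.integrable_of_hasCompactSupport hQc.mul_right
    have b1 : ∫ z, F2 z * ψ z = - ∫ z, P z * dX ψ z := by
      have := ibp_fderiv isOpen_univ hψ.contDiffOn hPs hPc (subset_univ _) 1
      have e1 : ∫ z, F2 z * ψ z = ∫ z, ψ z * fderiv ℝ P z 1 := by
        congr 1; funext z; rw [mul_comm]; rfl
      have e2 : ∫ z, P z * dX ψ z = ∫ z, fderiv ℝ ψ z 1 * P z := by
        congr 1; funext z; rw [mul_comm]; rfl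
      rw [e1, e2, this]
    have b2 : ∫ z, F3 z * ψ z = - ∫ z, Q z * dY ψ z := by
      have := ibp_fderiv isOpen_univ hψ.contDiffOn hQs hQc (subset_univ _) Complex.I
      have e1 : ∫ z, F3 z * ψ z = ∫ z, ψ z * fderiv ℝ Q z Complex.I := by
        congr 1; funext z; rw [mul_comm]; rfl
      have e2 : ∫ z, Q z * dY ψ z = ∫ z, fderiv ℝ ψ z Complex.I * Q z := by
        congr 1; funext z; rw [mul_comm]; rfl
      rw [e1, e2, this]
    have e1 : ∀ z, (Gc z * χ z) * lapC ψ z = Gc z * lapC (fun w => χ w * ψ w) z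
        - 2 * (P z * dX ψ z) - 2 * (Q z * dY ψ z) - F4 z * ψ z := by
      intro z
      rw [lap_mul hχs hψ]
      simp only [hP, hQ, hF4]
      ring
    have e2 : ∀ z, F z * ψ z = F1 z * ψ z + 2 * (F2 z * ψ z) + 2 * (F3 z * ψ z) - F4 z * ψ z := by
      intro z
      simp only [hF]
      ring
    have e3 : ∫ z, N z * Gc z * (χ z * ψ z) = ∫ z, F1 z * ψ z := by
      congr 1; funext z; simp only [hF1]; ring
    simp only [e1, e2]
    rw [int4a j0 j5 j6 j4, int4b j1 j2 j3 j4]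
    rw [h0, e3, b1, b2, hχp.eq_of_nhds]
    ring
  obtain ⟨r1, r2⟩ := weak_deriv hgs iF hFc hd hφ hc
  have e1 : (fun z => dd (fun w => Gc w * χ w) z * φ z) = fun z => dd Gc z * φ z := by
    funext z
    by_cases hz : z ∈ tsupport φ
    · have : (fun w => Gc w * χ w) =ᶠ[𝓝 z] Gc := by
        filter_upwards [hχ1 z (Or.inl hz)] with w hw
        simp [hw]
      simp only [dd, dX_congr this, dY_congr this]
    · simp [image_eq_zero_of_notMem_tsupport hz]
  have e2 : (fun z => Gc z * χ z * dd φ z) = fun z => Gc z * dd φ z := by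
    funext z
    by_cases hz : z ∈ tsupport φ
    · rw [(hχ1 z (Or.inl hz)).eq_of_nhds, mul_one]
    · simp [image_eq_zero_of_notMem_tsupport (fun h => hz (tsupport_dd φ h))]
  rw [e1] at r1 r2
  rw [e2] at r2
  exact ⟨r1, r2⟩

end core

end Aux4

namespace Aux4

open Set Filter Topology

lemma fderiv_ofReal (u : ℂ → ℝ) (z v : ℂ) :
    fderiv ℝ (fun w => ((u w : ℝ) : ℂ)) z v = ((fderiv ℝ u z v : ℝ) : ℂ) := by
  by_cases h : DifferentiableAt ℝ u z
  · have : HasFDerivAt (fun w => ((u w : ℝ) : ℂ)) (Complex.ofRealCLM.comp (fderiv ℝ u z)) z :=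
      Complex.ofRealCLM.hasFDerivAt.comp z h.hasFDerivAt
    rw [this.fderiv]; rfl
  · have h2 : ¬ DifferentiableAt ℝ (fun w => ((u w : ℝ) : ℂ)) z := by
      intro h3
      apply h
      have := Complex.reCLM.differentiableAt.comp z h3
      exact this
    rw [fderiv_zero_of_not_differentiableAt h, fderiv_zero_of_not_differentiableAt h2]
    simp

lemma dX_ofReal (u : ℂ → ℝ) : dX (fun w => ((u w : ℝ) : ℂ)) = fun z => ((dXr u z : ℝ) : ℂ) :=
  funext fun z => fderiv_ofReal u z 1

lemma dY_ofReal (u : ℂ → ℝ) : dY (fun w => ((u w : ℝ) : ℂ)) = fun z => ((dYr u z : ℝ) : ℂ) :=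
  funext fun z => fderiv_ofReal u z Complex.I

lemma lapC_ofReal (u : ℂ → ℝ) (z : ℂ) :
    lapC (fun w => ((u w : ℝ) : ℂ)) z = ((lapr u z : ℝ) : ℂ) := by
  rw [lapC, dX_ofReal, dY_ofReal, dX_ofReal, dY_ofReal, lapr]
  push_cast; rfl

lemma conj_dd_ofReal (u : ℂ → ℝ) (z : ℂ) :
    conj (dd (fun w => ((u w : ℝ) : ℂ)) z) = dbar (fun w => ((u w : ℝ) : ℂ)) z := by
  have h2 : conj (2 : ℂ) = 2 := Complex.conj_ofNat 2
  simp [dd, dbar, dX_ofReal, dY_ofReal, h2]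

lemma fderiv_conj {φ : ℂ → ℂ} {z : ℂ} (h : DifferentiableAt ℝ φ z) (v : ℂ) :
    fderiv ℝ (fun w => conj (φ w)) z v = conj (fderiv ℝ φ z v) := by
  have : HasFDerivAt (fun w => conj (φ w))
      ((Complex.conjCLE : ℂ →L[ℝ] ℂ).comp (fderiv ℝ φ z)) z :=
    (Complex.conjCLE : ℂ →L[ℝ] ℂ).hasFDerivAt.comp z h.hasFDerivAt
  rw [this.fderiv]; rfl

lemma dd_conj {φ : ℂ → ℂ} {z : ℂ} (h : DifferentiableAt ℝ φ z) :
    dd (fun w => conj (φ w)) z = conj (dbar φ z) := by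
  have h2 : conj (2 : ℂ) = 2 := Complex.conj_ofNat 2
  simp [dd, dbar, dX, dY, fderiv_conj h, h2]
  ring

lemma dbar_mul {f g : ℂ → ℂ} {z : ℂ} (hf : DifferentiableAt ℝ f z) (hg : DifferentiableAt ℝ g z) :
    dbar (fun w => f w * g w) z = dbar f z * g z + f z * dbar g z := by
  simp only [dbar, dX_mul hf hg, dY_mul hf hg]
  ring

lemma dbar_sub {f g : ℂ → ℂ} {z : ℂ} (hf : DifferentiableAt ℝ f z) (hg : DifferentiableAt ℝ g z) :
    dbar (fun w => 2 * f w - g w) z = 2 * dbar f z - dbar g z := by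
  have : HasFDerivAt (fun w => 2 * f w - g w) ((2 : ℂ) • fderiv ℝ f z - fderiv ℝ g z) z :=
    (hf.hasFDerivAt.const_mul 2).sub hg.hasFDerivAt
  simp only [dbar, dX, dY, this.fderiv]
  simp
  ring

section core

variable {Ω : Set ℂ} {p : ℂ} {g : ℂ → ℝ} {N : ℂ → ℂ}

lemma core_dbar (hΩ : IsOpen Ω) (hp : p ∈ Ω)
    (hs : ContDiffOn ℝ (⊤ : ℕ∞) (fun w => ((g w : ℝ) : ℂ)) (Ω \ {p})) (hN : Continuous N)
    (hdist : ∀ φ : ℂ → ℂ, ContDiff ℝ (⊤ : ℕ∞) φ → HasCompactSupport φ → tsupport φ ⊆ Ω →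
      ∫ z, ((g z : ℝ) : ℂ) * lapC φ z = (∫ z, N z * ((g z : ℝ) : ℂ) * φ z) + φ p)
    {φ : ℂ → ℂ} (hφ : ContDiff ℝ (⊤ : ℕ∞) φ) (hc : HasCompactSupport φ) (ht : tsupport φ ⊆ Ω) :
    Integrable (fun z => dbar (fun w => ((g w : ℝ) : ℂ)) z * φ z) ∧
      ∫ z, ((g z : ℝ) : ℂ) * dbar φ z = - ∫ z, dbar (fun w => ((g w : ℝ) : ℂ)) z * φ z := by
  have hs' : ContDiff ℝ (⊤ : ℕ∞) (fun w => conj (φ w)) :=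
    (Complex.conjCLE : ℂ →L[ℝ] ℂ).contDiff.comp hφ
  have ht' : tsupport (fun w => conj (φ w)) ⊆ tsupport φ := by
    apply closure_mono
    intro z hz h0
    exact hz (by simp [h0])
  obtain ⟨r1, r2⟩ := core_dd hΩ hp hs hN hdist hs' (hcs_of_tsupport hc ht') (ht'.trans ht)
  have e : ∀ z, dbar (fun w => ((g w : ℝ) : ℂ)) z * φ z
      = conj (dd (fun w => ((g w : ℝ) : ℂ)) z * conj (φ z)) := by
    intro z
    rw [map_mul, conj_dd_ofReal, Complex.conj_conj]
  have e' : ∀ z, ((g z : ℝ) : ℂ) * dbar φ z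
      = conj (((g z : ℝ) : ℂ) * dd (fun w => conj (φ w)) z) := by
    intro z
    rw [map_mul, dd_conj (hφ.differentiable (by simp) z), Complex.conj_conj, Complex.conj_ofReal]
  constructor
  · simp only [e]
    exact (Complex.conjCLE : ℂ →L[ℝ] ℂ).integrable_comp r1
  · simp only [e, e']
    rw [integral_conj, integral_conj, r2, map_neg]

end core

end Aux4

/-- The function `κ(ω₁,ω₂) = conj(∇₂)G^m(ω₁,ω₂) − conj(α)(ω₂) G^m(ω₁,ω₂)`
(where `conj(∇₂)G = 2∂₂G` for real `G`) satisfies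
`∂̄₂ κ(ω₁,·) = (1/2)δ_{ω₁} − (conj(α)/2)·conj(κ(ω₁,·))` in the sense of distributions;
in particular `κ(ω₁,·)` is `(−conj α)`-massive holomorphic away from `ω₁`. -/
theorem stmt4 (Ω : Set ℂ) (hΩ : IsOpen Ω) (hΩb : Bornology.IsBounded Ω)
    (V : ℂ → ℝ) (hV : ContDiff ℝ (⊤ : ℕ∞) V)
    (M : ℂ → ℝ) (hM : ∀ z, M z = lapr V z + ((dXr V z) ^ 2 + (dYr V z) ^ 2))
    (hMpos : ∀ z ∈ Ω, 0 ≤ M z)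
    (α : ℂ → ℂ) (hα : ∀ z, α z = (dXr V z : ℂ) + Complex.I * (dYr V z : ℂ))
    (G : ℂ → ℂ → ℝ) (ω₁ : ℂ) (hω₁ : ω₁ ∈ Ω)
    (hGsm : ContDiffOn ℝ (⊤ : ℕ∞) (G ω₁) (Ω \ {ω₁}))
    -- the massive Green function: `Δ₂ G^m(ω₁,·) = M·G^m(ω₁,·)` pointwise away from `ω₁` …
    (hGpde : ∀ z ∈ Ω \ {ω₁}, lapr (G ω₁) z = M z * G ω₁ z)
    -- … and `Δ₂ G^m(ω₁,·) = M·G^m(ω₁,·) + δ_{ω₁}` in the sense of distributions on `Ω`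
    (hGdist : ∀ φ : ℂ → ℂ, ContDiff ℝ (⊤ : ℕ∞) φ → HasCompactSupport φ → tsupport φ ⊆ Ω →
      ∫ z, (G ω₁ z : ℂ) * lapC φ z = (∫ z, ((M z * G ω₁ z : ℝ) : ℂ) * φ z) + φ ω₁)
    (κ : ℂ → ℂ)
    (hκ : ∀ z, κ z = 2 * dd (fun w => ((G ω₁ w : ℝ) : ℂ)) z - conj (α z) * (G ω₁ z : ℂ)) :
    -- distributional identity `∂̄κ = (1/2)δ_{ω₁} − (conj α /2)·conj κ`
    (∀ φ : ℂ → ℂ, ContDiff ℝ (⊤ : ℕ∞) φ → HasCompactSupport φ → tsupport φ ⊆ Ω →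
      -∫ z, κ z * dbar φ z
        = (1 / 2) * φ ω₁ - ∫ z, (conj (α z) / 2) * conj (κ z) * φ z) ∧
    -- pointwise: `κ(ω₁,·)` is `(−conj α)`-massive holomorphic away from `ω₁`
    (∀ z ∈ Ω \ {ω₁}, dbar κ z = -(1 / 2) * conj (α z) * conj (κ z)) := by
  classical
  set γ : ℂ → ℂ := fun w => ((G ω₁ w : ℝ) : ℂ) with hγ
  set Vc : ℂ → ℂ := fun w => ((V w : ℝ) : ℂ) with hVc
  set N : ℂ → ℂ := fun w => ((M w : ℝ) : ℂ) with hN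
  set A : ℂ → ℂ := fun w => conj (α w) with hA
  have hVs : ContDiff ℝ (⊤ : ℕ∞) Vc := Complex.ofRealCLM.contDiff.comp hV
  have hγs : ContDiffOn ℝ (⊤ : ℕ∞) γ (Ω \ {ω₁}) :=
    Complex.ofRealCLM.contDiff.comp_contDiffOn hGsm
  have hAdd : A = fun w => 2 * dd Vc w := by
    funext w
    simp only [hA, hα, hVc, dd, Aux4.dX_ofReal, Aux4.dY_ofReal]
    simp
    ring
  have hAs : ContDiff ℝ (⊤ : ℕ∞) A := by
    rw [hAdd]; exact contDiff_const.mul (Aux4.contDiff_dd hVs)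
  have hdA : ∀ z, dbar A z = ((lapr V z : ℝ) : ℂ) / 2 := by
    intro z
    have h1 := Aux4.dbar_dd (f := Vc) (z := z) hVs.contDiffAt
    rw [Aux4.lapC_ofReal] at h1
    have h2 := Aux4.dbar_sub (f := dd Vc) (g := fun _ => 0) (z := z)
      ((Aux4.contDiff_dd hVs).differentiable (by simp) z) (differentiableAt_const _)
    have h3 : dbar (fun _ : ℂ => (0 : ℂ)) z = 0 := by simp [dbar, dX, dY]
    rw [hAdd]
    simp only [sub_zero, h3] at h2
    rw [h2, ← h1]; ring
  have hMid : ∀ z, N z / 2 - dbar A z = A z * α z / 2 := by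
    intro z
    rw [hdA]
    simp only [hN, hM, hA, hα]
    simp
    ring_nf
    simp
    ring
  have hNc : Continuous N := by
    have : N = fun z => 2 * (dbar A z + A z * α z / 2) := by
      funext z; rw [← hMid]; ring
    have hαc : Continuous α := by
      have e : α = fun z => conj (A z) := by funext z; simp [hA]
      rw [e]; exact Complex.continuous_conj.comp hAs.continuous
    rw [this]
    exact continuous_const.mul ((Aux4.contDiff_dbar hAs).continuous.add
      ((hAs.continuous.mul hαc).div_const _))
  have hdist : ∀ φ : ℂ → ℂ, ContDiff ℝ (⊤ : ℕ∞) φ → HasCompactSupport φ → tsupport φ ⊆ Ω →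
      ∫ z, γ z * lapC φ z = (∫ z, N z * γ z * φ z) + φ ω₁ := by
    intro φ h1 h2 h3
    have := hGdist φ h1 h2 h3
    simp only [Complex.ofReal_mul] at this
    exact this
  have hcκ : ∀ z, conj (κ z) = 2 * dbar γ z - α z * γ z := by
    intro z
    rw [hκ, map_sub, map_mul, map_mul, Aux4.conj_dd_ofReal, Complex.conj_conj,
      Complex.conj_ofReal, Complex.conj_ofNat]
  have hκ' : κ = fun z => 2 * dd γ z - A z * γ z := funext hκ
  constructor
  · intro φ hφ hc ht
    have hdφ := Aux4.contDiff_dbar hφ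
    have hdφt := Aux4.tsupport_dbar φ
    have hdφc := Aux4.hcs_of_tsupport hc hdφt
    obtain ⟨ia, ea⟩ := Aux4.core_dd hΩ hω₁ hγs hNc hdist hdφ hdφc (hdφt.trans ht)
    have hAφ : ContDiff ℝ (⊤ : ℕ∞) (fun z => A z * φ z) := hAs.mul hφ
    have hAφt : tsupport (fun z => A z * φ z) ⊆ tsupport φ := tsupport_mul_subset_right (f := A)
    obtain ⟨id, ed⟩ := Aux4.core_dbar hΩ hω₁ hγs hNc hdist hAφ
      (Aux4.hcs_of_tsupport hc hAφt) (hAφt.trans ht)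
    have hGmul : ∀ {a b : ℂ → ℂ}, Continuous a → Continuous b → HasCompactSupport b →
        tsupport b ⊆ Ω → Integrable (fun z => γ z * (a z * b z)) := by
      intro a b ha hb hbc hbt
      exact Aux4.G_mul_int hΩ hω₁ hγs hdist (φ := fun z => a z * b z) (ha.mul hb) hbc.mul_left
        ((tsupport_mul_subset_right (f := a)).trans hbt)
    have ib := hGmul (Aux4.contDiff_dbar hAs).continuous hφ.continuous hc ht
    have ic := hGmul hAs.continuous hdφ.continuous hdφc (hdφt.trans ht)
    have im := hGmul hNc hφ.continuous hc ht
    have ea' : ∫ z, dd γ z * dbar φ z = - ((∫ z, γ z * (N z * φ z)) + φ ω₁) / 4 := by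
      have e1 : ∫ z, γ z * lapC φ z = 4 * ∫ z, γ z * dd (dbar φ) z := by
        rw [← integral_const_mul]
        congr 1; funext z
        rw [← Aux4.dd_dbar hφ.contDiffAt]; ring
      have e2 : ∫ z, N z * γ z * φ z = ∫ z, γ z * (N z * φ z) := by
        congr 1; funext z; ring
      have e3 := hdist φ hφ hc ht
      rw [e1, e2, ea] at e3
      rw [← e3]; ring
    have ed' : (∫ z, γ z * (dbar A z * φ z)) + ∫ z, γ z * (A z * dbar φ z)
        = - ∫ z, dbar γ z * (A z * φ z) := by
      rw [← ed, ← integral_add ib ic]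
      congr 1; funext z
      rw [Aux4.dbar_mul (hAs.differentiable (by simp) z) (hφ.differentiable (by simp) z)]
      simp only [hγ]
      ring
    have el : ∫ z, κ z * dbar φ z
        = 2 * (∫ z, dd γ z * dbar φ z) - ∫ z, γ z * (A z * dbar φ z) := by
      rw [← integral_const_mul, ← integral_sub (ia.const_mul 2) ic]
      congr 1; funext z
      rw [hκ']; ring
    have er : ∫ z, (conj (α z) / 2) * conj (κ z) * φ z
        = (∫ z, dbar γ z * (A z * φ z)) - ((1 / 2) * (∫ z, γ z * (N z * φ z))
          - ∫ z, γ z * (dbar A z * φ z)) := by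
      have i2 : Integrable (fun z => (1 / 2) * (γ z * (N z * φ z)) - γ z * (dbar A z * φ z)) :=
        (im.const_mul (1 / 2)).sub ib
      rw [← integral_const_mul, ← integral_sub (im.const_mul (1 / 2)) ib, ← integral_sub id i2]
      congr 1; funext z
      have h1 := hMid z
      rw [hcκ]
      change A z / 2 * _ * _ = _
      linear_combination (γ z * φ z) * h1
    rw [el, er, ea']
    linear_combination ed'
  · intro z hz
    have hU : IsOpen (Ω \ {ω₁}) := hΩ.sdiff isClosed_singleton
    have hγz := hγs.contDiffAt (hU.mem_nhds hz)
    have hγd := hγz.differentiableAt (by simp)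
    have hAd := hAs.differentiable (by simp) z
    have h1 := Aux4.dbar_sub (f := dd γ) (g := fun w => A w * γ w) (z := z)
      ((Aux4.contDiffAt_dd hγz).differentiableAt (by simp)) (hAd.mul hγd)
    have h2 := Aux4.dbar_dd hγz
    rw [Aux4.lapC_ofReal, hGpde z hz, Complex.ofReal_mul] at h2
    change _ = N z * γ z at h2
    have h3 := hMid z
    rw [hcκ, hκ', h1, Aux4.dbar_mul hAd hγd]
    change _ = -(1 / 2) * A z * _
    linear_combination (1 / 2) * h2 + γ z * h3
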